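/- arXiv:1109.5908 — 2 statements merged into one kernel-verified Lean document; each statement's English description precedes it below -/
import Mathlib

section
/- Let k ≥ 0 and let the vertices of the path P_{3k+2} be labeled 1 through 3k+2 consecutively. Write a vertex v as v = 3q + r with integers q ≥ 0 and 0 ≤ r < 3. Then DV(v) = 0 if v ≡ 0 (mod 3); DV(v) = 1 + q if v ≡ 1 (mod 3); and DV(v) = k + 1 − q if v ≡ 2 (mod 3). -/
open SimpleGraph Finset
open scoped Classical

/-- `D` is a dominating set of `G`: every vertex not in `D` is adjacent to a vertex in `D`. -/
def isDomSet {V : Type*} (G : SimpleGraph V) (D : Finset V) : Prop :=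
  ∀ v : V, v ∉ D → ∃ u ∈ D, G.Adj u v

/-- The domination number `γ(G)`: minimum cardinality of a dominating set of `G`. -/
noncomputable def domNum {V : Type*} [Fintype V] (G : SimpleGraph V) : ℕ :=
  sInf {n | ∃ D : Finset V, isDomSet G D ∧ D.card = n}

/-- The collection of minimum dominating sets (`γ(G)`-sets) of `G`. -/
noncomputable def gammaSets {V : Type*} [Fintype V] (G : SimpleGraph V) : Finset (Finset V) :=
  Finset.univ.filter (fun D => isDomSet G D ∧ D.card = domNum G)

/-- `τ(G)`: the total number of `γ(G)`-sets. -/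
noncomputable def tau {V : Type*} [Fintype V] (G : SimpleGraph V) : ℕ :=
  (gammaSets G).card

/-- The domination value `DV_G(v)`: the number of `γ(G)`-sets containing `v`. -/
noncomputable def DV {V : Type*} [Fintype V] (G : SimpleGraph V) (v : V) : ℕ :=
  ((gammaSets G).filter (fun D => v ∈ D)).card

lemma isDomSet_pathGraph_iff {n : ℕ} (D : Finset (Fin n)) :
    isDomSet (pathGraph n) D ↔ ∀ m < n, ∃ x ∈ D, x.val ≤ m + 1 ∧ m ≤ x.val + 1 := by
  constructor
  · intro h m hm
    by_cases hD : (⟨m, hm⟩ : Fin n) ∈ D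
    · exact ⟨_, hD, by simp, by simp⟩
    · obtain ⟨u, hu, hadj⟩ := h _ hD
      rw [pathGraph_adj] at hadj
      exact ⟨u, hu, by simp only at hadj; omega, by simp only at hadj; omega⟩
  · intro h v hv
    obtain ⟨x, hx, h1, h2⟩ := h v v.isLt
    have hne : x.val ≠ v.val := fun he => hv (Fin.ext he ▸ hx)
    exact ⟨x, hx, by rw [pathGraph_adj]; omega⟩

/-- The dominating set `{1, 4, …, 3j - 2} ∪ {3j, 3j + 3, …, 3k}` of the path on
`0, 1, …, 3k + 1`. -/
def pathGammaSet (k j : ℕ) : Finset (Fin (3 * k + 2)) :=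
  Finset.univ.filter fun x => x.val % 3 = 1 ∧ x.val / 3 < j ∨ x.val % 3 = 0 ∧ j ≤ x.val / 3

lemma mem_pathGammaSet {k j : ℕ} {x : Fin (3 * k + 2)} :
    x ∈ pathGammaSet k j ↔
      x.val % 3 = 1 ∧ x.val / 3 < j ∨ x.val % 3 = 0 ∧ j ≤ x.val / 3 := by
  simp [pathGammaSet]

lemma isDomSet_pathGammaSet (k j : ℕ) :
    isDomSet (pathGraph (3 * k + 2)) (pathGammaSet k j) := by
  rw [isDomSet_pathGraph_iff]
  intro m hm
  by_cases hj : m / 3 < j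
  · exact ⟨⟨3 * (m / 3) + 1, by omega⟩, by rw [mem_pathGammaSet]; simp only; omega,
      by simp only; omega, by simp only; omega⟩
  · by_cases hr : m % 3 = 2
    · exact ⟨⟨3 * (m / 3) + 3, by omega⟩, by rw [mem_pathGammaSet]; simp only; omega,
        by simp only; omega, by simp only; omega⟩
    · exact ⟨⟨3 * (m / 3), by omega⟩, by rw [mem_pathGammaSet]; simp only; omega,
        by simp only; omega, by simp only; omega⟩

lemma card_pathGammaSet (k j : ℕ) : (pathGammaSet k j).card = k + 1 := by
  rw [← Finset.card_range (k + 1)]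
  refine Finset.card_bij (fun x _ => x.val / 3) ?_ ?_ ?_
  · intro x _
    have := x.isLt
    rw [Finset.mem_range]
    omega
  · intro x hx y hy hxy
    rw [mem_pathGammaSet] at hx hy
    ext
    omega
  · intro i hi
    rw [Finset.mem_range] at hi
    by_cases hj : i < j
    · exact ⟨⟨3 * i + 1, by omega⟩, by rw [mem_pathGammaSet]; simp only; omega,
        by simp only; omega⟩
    · exact ⟨⟨3 * i, by omega⟩, by rw [mem_pathGammaSet]; simp only; omega,
        by simp only; omega⟩

lemma image_div_three_of_isDomSet {k : ℕ} {D : Finset (Fin (3 * k + 2))}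
    (hD : isDomSet (pathGraph (3 * k + 2)) D) :
    D.image (fun x => x.val / 3) = Finset.range (k + 1) := by
  rw [isDomSet_pathGraph_iff] at hD
  ext i
  simp only [Finset.mem_image, Finset.mem_range]
  constructor
  · rintro ⟨x, -, rfl⟩
    omega
  · intro hi
    obtain ⟨x, hx, h1, h2⟩ := hD (3 * i + 1) (by omega)
    exact ⟨x, hx, by omega⟩

lemma image_succ_div_three_of_isDomSet {k : ℕ} {D : Finset (Fin (3 * k + 2))}
    (hD : isDomSet (pathGraph (3 * k + 2)) D) :
    D.image (fun x => (x.val + 1) / 3) = Finset.range (k + 1) := by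
  rw [isDomSet_pathGraph_iff] at hD
  ext i
  simp only [Finset.mem_image, Finset.mem_range]
  constructor
  · rintro ⟨x, -, rfl⟩
    omega
  · intro hi
    obtain ⟨x, hx, h1, h2⟩ := hD (3 * i) (by omega)
    exact ⟨x, hx, by omega⟩

lemma domNum_pathGraph_three_mul_add_two (k : ℕ) :
    domNum (pathGraph (3 * k + 2)) = k + 1 := by
  refine IsLeast.csInf_eq ⟨⟨_, isDomSet_pathGammaSet k 0, card_pathGammaSet k 0⟩, ?_⟩
  rintro n ⟨D, hD, rfl⟩
  rw [← Finset.card_range (k + 1), ← image_div_three_of_isDomSet hD]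
  exact Finset.card_image_le

lemma exists_eq_pathGammaSet {k : ℕ} {D : Finset (Fin (3 * k + 2))}
    (hD : isDomSet (pathGraph (3 * k + 2)) D) (hcard : D.card = k + 1) :
    ∃ j ≤ k + 1, D = pathGammaSet k j := by
  have himage := image_div_three_of_isDomSet hD
  have hinj : Set.InjOn (fun x : Fin (3 * k + 2) => x.val / 3) D := by
    rw [← Finset.card_image_iff, himage, hcard, Finset.card_range]
  have huniq : ∀ x ∈ D, ∀ y ∈ D, x.val / 3 = y.val / 3 → x.val = y.val :=
    fun x hx y hy h => congrArg Fin.val (hinj hx hy h)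
  have hexists : ∀ i ≤ k, ∃ x ∈ D, x.val / 3 = i := fun i hi =>
    Finset.mem_image.1 (himage ▸ Finset.mem_range.2 (Nat.lt_succ_of_le hi))
  have hexists' : ∀ i ≤ k, ∃ x ∈ D, (x.val + 1) / 3 = i := fun i hi =>
    Finset.mem_image.1 (image_succ_div_three_of_isDomSet hD ▸
      Finset.mem_range.2 (Nat.lt_succ_of_le hi))
  rw [isDomSet_pathGraph_iff] at hD
  have hmod : ∀ i, ∀ x ∈ D, x.val ≠ 3 * i + 2 := by
    intro i
    induction i with
    | zero =>
      intro x hx hxi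
      obtain ⟨y, hy, hyi⟩ := hexists' 0 (by omega)
      have := huniq x hx y hy (by omega)
      omega
    | succ i ih =>
      intro x hx hxi
      obtain ⟨y, hy, hyi⟩ := hexists' (i + 1) (by omega)
      have := ih y hy
      have := huniq x hx y hy
      omega
  have hmod' : ∀ x ∈ D, x.val % 3 ≠ 2 := fun x hx h => hmod (x.val / 3) x hx (by omega)
  have hstep : ∀ i, ∀ x ∈ D, x.val = 3 * i → ∀ d, ∀ y ∈ D,
      y.val / 3 = i + d → y.val % 3 = 0 := by
    intro i x hx hxi d
    induction d with
    | zero =>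
      intro y hy hyi
      have := huniq x hx y hy
      omega
    | succ d ih =>
      intro y hy hyi
      obtain ⟨z, hz, h1, h2⟩ := hD (3 * (i + d) + 2) (by omega)
      have := hmod' z hz
      have := ih z hz
      have := huniq z hz y hy
      omega
  have hbound : ∃ j, j = k + 1 ∨ ∃ x ∈ D, x.val = 3 * j := ⟨k + 1, Or.inl rfl⟩
  set j := Nat.find hbound
  have hjspec : j = k + 1 ∨ ∃ x ∈ D, x.val = 3 * j := Nat.find_spec hbound
  have hjmin : ∀ x ∈ D, x.val % 3 = 0 → j ≤ x.val / 3 := fun x hx h =>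
    Nat.find_min' hbound (Or.inr ⟨x, hx, by omega⟩)
  have hjge : ∀ x ∈ D, j ≤ x.val / 3 → x.val % 3 = 0 := by
    intro x hx hle
    rcases hjspec with h | ⟨y, hy, hyj⟩
    · omega
    · exact hstep j y hy hyj (x.val / 3 - j) x hx (by omega)
  refine ⟨j, Nat.find_min' hbound (Or.inl rfl), ?_⟩
  refine Finset.eq_of_subset_of_card_le ?_ (by rw [card_pathGammaSet, hcard])
  intro x hx
  rw [mem_pathGammaSet]
  have := hmod' x hx
  have := hjmin x hx
  have := hjge x hx
  omega

lemma gammaSets_pathGraph_three_mul_add_two (k : ℕ) :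
    gammaSets (pathGraph (3 * k + 2)) = (Finset.range (k + 2)).image (pathGammaSet k) := by
  ext D
  simp only [gammaSets, Finset.mem_filter, Finset.mem_univ, true_and, Finset.mem_image,
    Finset.mem_range, domNum_pathGraph_three_mul_add_two]
  constructor
  · rintro ⟨hD, hcard⟩
    obtain ⟨j, hj, rfl⟩ := exists_eq_pathGammaSet hD hcard
    exact ⟨j, by omega, rfl⟩
  · rintro ⟨j, -, rfl⟩
    exact ⟨isDomSet_pathGammaSet k j, card_pathGammaSet k j⟩

lemma pathGammaSet_injOn (k : ℕ) :
    Set.InjOn (pathGammaSet k) (Finset.range (k + 2)) := by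
  have key : ∀ i j, i < j → j < k + 2 → pathGammaSet k i ≠ pathGammaSet k j := by
    intro i j hij hj h
    have hi : (⟨3 * i, by omega⟩ : Fin (3 * k + 2)) ∈ pathGammaSet k i := by
      rw [mem_pathGammaSet]; simp only; omega
    rw [h, mem_pathGammaSet] at hi
    simp only at hi
    omega
  intro i hi j hj h
  rw [Finset.mem_coe, Finset.mem_range] at hi hj
  rcases lt_trichotomy i j with hij | hij | hij
  · exact absurd h (key i j hij hj)
  · exact hij
  · exact absurd h.symm (key j i hij hi)

lemma DV_pathGraph_eq_card_filter (k : ℕ) (x : Fin (3 * k + 2)) :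
    DV (pathGraph (3 * k + 2)) x =
      ((Finset.range (k + 2)).filter fun j => x ∈ pathGammaSet k j).card := by
  rw [← Finset.card_image_of_injOn
    ((pathGammaSet_injOn k).mono (Finset.coe_subset.2 (Finset.filter_subset _ _))),
    DV, gammaSets_pathGraph_three_mul_add_two]
  congr 1
  ext D
  simp only [Finset.mem_filter, Finset.mem_image]
  constructor
  · rintro ⟨⟨j, hj, rfl⟩, hx⟩
    exact ⟨j, ⟨hj, hx⟩, rfl⟩
  · rintro ⟨j, ⟨hj, hx⟩, rfl⟩
    exact ⟨⟨j, hj, rfl⟩, hx⟩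

theorem DV_pathGraph_three_mul_add_two (k : ℕ) (v q r : ℕ)
    (hv1 : 1 ≤ v) (hv2 : v ≤ 3 * k + 2) (hqr : v = 3 * q + r) (hr : r < 3) :
    DV (pathGraph (3 * k + 2)) ⟨v - 1, by omega⟩ =
      if r = 0 then 0
      else if r = 1 then 1 + q
      else k + 1 - q := by
  rw [DV_pathGraph_eq_card_filter]
  simp only [mem_pathGammaSet]
  split_ifs with h0 h1
  · rw [Finset.card_eq_zero, Finset.filter_eq_empty_iff]
    intro j _
    omega
  · rw [add_comm 1 q, ← Finset.card_range (q + 1)]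
    congr 1
    ext j
    simp only [Finset.mem_filter, Finset.mem_range]
    omega
  · have hcard : (Finset.Ico (q + 1) (k + 2)).card = k + 1 - q := by
      rw [Nat.card_Ico]; omega
    rw [← hcard]
    congr 1
    ext j
    simp only [Finset.mem_filter, Finset.mem_range, Finset.mem_Ico]
    omega
end

section
/- View P_2 □ P_n as two copies of P_n with vertices x_1,…,x_n and y_1,…,y_n and edges x_i y_i. (i) For every vertex v of P_2 □ P_3, DV(v) = 1. (ii) For odd n ≥ 5 and 1 ≤ i ≤ n, DV(x_i) = DV(y_i) = 1 if i is odd, and DV(x_i) = DV(y_i) = 0 if i is even. -/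
open SimpleGraph Finset
open scoped Classical

theorem sum_range_closed_nbhd (c : ℕ → ℕ) (n : ℕ) :
    ∑ j ∈ range n, (c j + 2 * c (j + 1) + c (j + 2)) + c 1 + c n =
      4 * ∑ j ∈ range n, c (j + 1) + c 0 + c (n + 1) := by
  induction n with
  | zero => simp [add_comm]
  | succ n ih =>
    rw [sum_range_succ, sum_range_succ, show n + 1 + 1 = n + 2 from rfl]
    omega

/-- `f` and `g` are the indicator sequences, padded by zeros at `0` and `n + 1`, of the two rows of
a dominating set of the ladder with `n` rungs. -/
structure IsLadderDom (n : ℕ) (f g : ℕ → ℕ) : Prop where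
  f_le : ∀ j, f j ≤ 1
  g_le : ∀ j, g j ≤ 1
  f_zero : f 0 = 0
  g_zero : g 0 = 0
  f_last : f (n + 1) = 0
  g_last : g (n + 1) = 0
  f_dom : ∀ j < n, 1 ≤ f j + f (j + 1) + f (j + 2) + g (j + 1)
  g_dom : ∀ j < n, 1 ≤ g j + g (j + 1) + g (j + 2) + f (j + 1)

namespace IsLadderDom

variable {n : ℕ} {f g : ℕ → ℕ}

theorem symm (h : IsLadderDom n f g) : IsLadderDom n g f :=
  ⟨h.g_le, h.f_le, h.g_zero, h.f_zero, h.g_last, h.f_last, h.g_dom, h.f_dom⟩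

theorem sum_eq (h : IsLadderDom n f g) :
    ∑ j ∈ range n, ((f j + g j) + 2 * (f (j + 1) + g (j + 1)) + (f (j + 2) + g (j + 2))) +
      (f 1 + g 1) + (f n + g n) = 4 * ∑ j ∈ range n, (f (j + 1) + g (j + 1)) := by
  have := sum_range_closed_nbhd (fun j => f j + g j) n
  simpa [h.f_zero, h.g_zero, h.f_last, h.g_last] using this

theorem two_le (h : IsLadderDom n f g) {j : ℕ} (hj : j < n) :
    2 ≤ (f j + g j) + 2 * (f (j + 1) + g (j + 1)) + (f (j + 2) + g (j + 2)) := by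
  have h1 := h.f_dom j hj
  have h2 := h.g_dom j hj
  omega

theorem le_two_mul_sum (h : IsLadderDom n f g) :
    n ≤ 2 * ∑ j ∈ range n, (f (j + 1) + g (j + 1)) := by
  have h1 := h.sum_eq
  have h2 := sum_le_sum fun j hj => h.two_le (mem_range.mp hj)
  simp only [sum_const, card_range, smul_eq_mul] at h2
  omega

/-- Total over-domination at two distinct rungs is controlled by the size of the set. -/
theorem excess_pair (h : IsLadderDom n f g)
    (hs : 2 * ∑ j ∈ range n, (f (j + 1) + g (j + 1)) = n + 1) {i k : ℕ} (hi : i < n) (hk : k < n)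
    (hik : i ≠ k) :
    ((f i + g i) + 2 * (f (i + 1) + g (i + 1)) + (f (i + 2) + g (i + 2))) +
      ((f k + g k) + 2 * (f (k + 1) + g (k + 1)) + (f (k + 2) + g (k + 2))) +
      (f 1 + g 1) + (f n + g n) ≤ 6 := by
  have h1 := h.sum_eq
  have hi' : i ∈ range n := mem_range.mpr hi
  have hk' : k ∈ (range n).erase i := mem_erase.mpr ⟨hik.symm, mem_range.mpr hk⟩
  rw [← add_sum_erase _ _ hi', ← add_sum_erase _ _ hk'] at h1
  have h2 := sum_le_sum (s := ((range n).erase i).erase k) fun j hj =>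
    h.two_le (mem_range.mp (mem_of_mem_erase (mem_of_mem_erase hj)))
  simp only [sum_const, smul_eq_mul, card_erase_of_mem hk', card_erase_of_mem hi', card_range]
    at h2
  omega

theorem ends_eq_one (h : IsLadderDom n f g) (hn : 5 ≤ n)
    (hs : 2 * ∑ j ∈ range n, (f (j + 1) + g (j + 1)) = n + 1) :
    f 1 + g 1 = 1 ∧ f n + g n = 1 := by
  obtain ⟨m, rfl⟩ : ∃ m, n = m + 2 := ⟨n - 2, by omega⟩
  have e := h.excess_pair hs (i := 1) (k := m) (by omega) (by omega) (by omega)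
  have e' := h.excess_pair hs (i := 0) (k := m + 1) (by omega) (by omega) (by omega)
  have t := h.two_le (j := 1) (by omega)
  have t' := h.two_le (j := m) (by omega)
  have a := h.f_dom 0 (by omega)
  have a' := h.g_dom 0 (by omega)
  have b := h.f_dom (m + 1) (by omega)
  have b' := h.g_dom (m + 1) (by omega)
  have := h.f_last
  have := h.g_last
  have := h.f_zero
  have := h.g_zero
  simp only [add_assoc, zero_add, Nat.reduceAdd] at *
  omega

theorem perfect (h : IsLadderDom n f g) (hn : 5 ≤ n)
    (hs : 2 * ∑ j ∈ range n, (f (j + 1) + g (j + 1)) = n + 1) {j : ℕ} (hj : j < n) :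
    (f j + g j) + 2 * (f (j + 1) + g (j + 1)) + (f (j + 2) + g (j + 2)) = 2 := by
  obtain ⟨k, hk, hjk⟩ : ∃ k < n, j ≠ k := by
    rcases Nat.eq_zero_or_pos j with h0 | h0
    · exact ⟨1, by omega, by omega⟩
    · exact ⟨0, by omega, by omega⟩
  have := h.excess_pair hs hj hk hjk
  have := h.two_le hj
  have := h.two_le hk
  have := h.ends_eq_one hn hs
  omega

theorem eq_alternating (h : IsLadderDom n f g) (hn : 5 ≤ n)
    (hs : 2 * ∑ j ∈ range n, (f (j + 1) + g (j + 1)) = n + 1) (h1 : f 1 = 1) (j : ℕ) (hj : j < n) :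
    f (j + 1) = (if j % 4 = 0 then 1 else 0) ∧ g (j + 1) = (if j % 4 = 2 then 1 else 0) := by
  have hends := h.ends_eq_one hn hs
  induction j using Nat.strong_induction_on with
  | _ j ih =>
    match j with
    | 0 =>
      simp
      omega
    | 1 =>
      have := h.perfect hn hs (j := 0) (by omega)
      have := h.f_zero
      have := h.g_zero
      simp at *
      omega
    | j + 2 =>
      have i0 := ih j (by omega) (by omega)
      have i1 := ih (j + 1) (by omega) (by omega)
      have p := h.perfect hn hs (j := j + 1) (by omega)
      have d := h.f_dom (j + 1) (by omega)
      have d' := h.g_dom (j + 1) (by omega)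
      simp only [add_assoc, Nat.reduceAdd] at *
      split_ifs at * <;> omega

end IsLadderDom

/-- The indicator sequence of row `r` of a set of vertices of a ladder, with rungs counted
from `1`. -/
noncomputable def rowIndicator {n : ℕ} (D : Finset (Fin 2 × Fin n)) (r : Fin 2) (j : ℕ) : ℕ :=
  if ∃ w ∈ D, w.1 = r ∧ (w.2 : ℕ) + 1 = j then 1 else 0

section Ladder

variable {n : ℕ} {D : Finset (Fin 2 × Fin n)}

theorem rowIndicator_of_mem {w : Fin 2 × Fin n} (hw : w ∈ D) {r : Fin 2} {j : ℕ} (hr : w.1 = r)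
    (hj : (w.2 : ℕ) + 1 = j) : rowIndicator D r j = 1 :=
  if_pos ⟨w, hw, hr, hj⟩

theorem rowIndicator_succ (r : Fin 2) (j : Fin n) :
    rowIndicator D r (j + 1) = if (r, j) ∈ D then 1 else 0 := by
  unfold rowIndicator
  congr 1
  simp only [eq_iff_iff]
  constructor
  · rintro ⟨⟨a, b⟩, hw, rfl, hb⟩
    obtain rfl : b = j := Fin.ext (by simpa using hb)
    exact hw
  · exact fun h => ⟨_, h, rfl, rfl⟩

theorem card_eq_sum_rowIndicator (D : Finset (Fin 2 × Fin n)) :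
    D.card = ∑ j ∈ range n, (rowIndicator D 0 (j + 1) + rowIndicator D 1 (j + 1)) := by
  rw [← Fin.sum_univ_eq_sum_range
    (fun j => rowIndicator D 0 (j + 1) + rowIndicator D 1 (j + 1))]
  simp only [rowIndicator_succ]
  rw [sum_add_distrib, ← Fin.sum_univ_two (fun r => ∑ j, if (r, j) ∈ D then 1 else 0),
    ← Fintype.sum_prod_type (fun v => if v ∈ D then 1 else 0)]
  simp

theorem ladder_adj (u v : Fin 2 × Fin n) :
    (pathGraph 2 □ pathGraph n).Adj u v ↔
      (u.1 ≠ v.1 ∧ u.2 = v.2) ∨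
        (((u.2 : ℕ) + 1 = v.2 ∨ (v.2 : ℕ) + 1 = u.2) ∧ u.1 = v.1) := by
  rw [boxProd_adj, pathGraph_adj, pathGraph_adj]
  have : (((u.1 : ℕ) + 1 = v.1 ∨ (v.1 : ℕ) + 1 = u.1)) ↔ u.1 ≠ v.1 := by
    rw [Ne, Fin.ext_iff]
    omega
  rw [this]

theorem one_le_of_isDomSet (hD : isDomSet (pathGraph 2 □ pathGraph n) D) {r s : Fin 2}
    (hrs : r ≠ s) {j : ℕ} (hj : j < n) :
    1 ≤ rowIndicator D r j + rowIndicator D r (j + 1) + rowIndicator D r (j + 2) +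
      rowIndicator D s (j + 1) := by
  by_cases hv : (r, (⟨j, hj⟩ : Fin n)) ∈ D
  · have : rowIndicator D r (j + 1) = 1 := rowIndicator_of_mem hv rfl rfl
    omega
  obtain ⟨u, hu, ha⟩ := hD _ hv
  rw [ladder_adj] at ha
  simp only at ha
  rcases ha with ⟨h1, h2⟩ | ⟨h1 | h1, h2⟩
  · have : rowIndicator D s (j + 1) = 1 := rowIndicator_of_mem hu (by omega) (by simp [h2])
    omega
  · have : rowIndicator D r j = 1 := rowIndicator_of_mem hu h2 h1
    omega
  · have : rowIndicator D r (j + 2) = 1 := rowIndicator_of_mem hu h2 (by omega)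
    omega

theorem isLadderDom_of_isDomSet (hD : isDomSet (pathGraph 2 □ pathGraph n) D) :
    IsLadderDom n (rowIndicator D 0) (rowIndicator D 1) := by
  have hle : ∀ r j, rowIndicator D r j ≤ 1 := fun r j => by unfold rowIndicator; split_ifs <;> omega
  have hzero : ∀ r, rowIndicator D r 0 = 0 := fun r => if_neg (by simp)
  have hlast : ∀ r, rowIndicator D r (n + 1) = 0 := fun r => if_neg (by
    rintro ⟨w, -, -, h⟩
    have := w.2.isLt
    omega)
  exact ⟨hle 0, hle 1, hzero 0, hzero 1, hlast 0, hlast 1,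
    fun j hj => one_le_of_isDomSet hD (by decide) hj,
    fun j hj => one_le_of_isDomSet hD (by decide) hj⟩

/-- The set of every second rung's vertex, alternating between the rows; `t` is the row of the
vertex on the first rung. -/
noncomputable def alternatingSet (n : ℕ) (t : Fin 2) : Finset (Fin 2 × Fin n) :=
  univ.filter fun v => (v.2 : ℕ) % 4 = if v.1 = t then 0 else 2

theorem mem_alternatingSet {t : Fin 2} {v : Fin 2 × Fin n} :
    v ∈ alternatingSet n t ↔ (v.2 : ℕ) % 4 = if v.1 = t then 0 else 2 := by
  simp [alternatingSet]

theorem isDomSet_alternatingSet (hn : Odd n) (t : Fin 2) :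
    isDomSet (pathGraph 2 □ pathGraph n) (alternatingSet n t) := by
  rintro ⟨r, j, hj⟩ hv
  obtain ⟨k, rfl⟩ := hn
  rw [mem_alternatingSet] at hv
  simp only at hv
  have key : (∃ s, r ≠ s ∧ (s, (⟨j, hj⟩ : Fin (2 * k + 1))) ∈ alternatingSet (2 * k + 1) t) ∨
      (∃ h : j + 1 < 2 * k + 1, (r, ⟨j + 1, h⟩) ∈ alternatingSet (2 * k + 1) t) ∨
      (1 ≤ j ∧ (r, ⟨j - 1, by omega⟩) ∈ alternatingSet (2 * k + 1) t) := by
    simp only [mem_alternatingSet]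
    rcases Nat.even_or_odd' j with ⟨m, hm | hm⟩
    · left
      refine ⟨1 - r, by omega, ?_⟩
      split_ifs at * <;> omega
    · right
      by_cases h : (j + 1) % 4 = if r = t then 0 else 2
      · exact Or.inl ⟨by omega, h⟩
      · refine Or.inr ⟨by omega, ?_⟩
        split_ifs at * <;> omega
  rcases key with ⟨s, hs, h⟩ | ⟨_, h⟩ | ⟨hj1, h⟩
  · exact ⟨_, h, (ladder_adj _ _).mpr (Or.inl ⟨hs.symm, rfl⟩)⟩
  · exact ⟨_, h, (ladder_adj _ _).mpr (Or.inr ⟨Or.inr rfl, rfl⟩)⟩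
  · exact ⟨_, h, (ladder_adj _ _).mpr (Or.inr ⟨Or.inl (Nat.sub_add_cancel hj1), rfl⟩)⟩

theorem sum_range_even (k : ℕ) :
    ∑ j ∈ range (2 * k + 1), (if j % 2 = 0 then 1 else 0) = k + 1 := by
  induction k with
  | zero => rfl
  | succ k ih =>
    rw [show 2 * (k + 1) + 1 = 2 * k + 1 + 1 + 1 by ring, sum_range_succ, sum_range_succ, ih,
      if_neg (by omega), if_pos (by omega)]

theorem card_alternatingSet (k : ℕ) (t : Fin 2) :
    (alternatingSet (2 * k + 1) t).card = k + 1 := by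
  rw [card_eq_sum_rowIndicator, ← sum_range_even k]
  refine sum_congr rfl fun j hj => ?_
  have h (r : Fin 2) := rowIndicator_succ (D := alternatingSet (2 * k + 1) t) r
    ⟨j, mem_range.mp hj⟩
  simp only [mem_alternatingSet] at h
  rw [h, h]
  fin_cases t <;> simp <;> split_ifs <;> omega

theorem succ_le_card_of_isDomSet {k : ℕ} {D : Finset (Fin 2 × Fin (2 * k + 1))}
    (hD : isDomSet (pathGraph 2 □ pathGraph (2 * k + 1)) D) : k + 1 ≤ D.card := by
  have := (isLadderDom_of_isDomSet hD).le_two_mul_sum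
  rw [← card_eq_sum_rowIndicator] at this
  omega

theorem domNum_ladder (k : ℕ) : domNum (pathGraph 2 □ pathGraph (2 * k + 1)) = k + 1 := by
  have hmem : k + 1 ∈ {m | ∃ D : Finset (Fin 2 × Fin (2 * k + 1)),
      isDomSet (pathGraph 2 □ pathGraph (2 * k + 1)) D ∧ D.card = m} :=
    ⟨_, isDomSet_alternatingSet ⟨k, rfl⟩ 0, card_alternatingSet k 0⟩
  refine le_antisymm (Nat.sInf_le hmem) (le_csInf ⟨_, hmem⟩ ?_)
  rintro m ⟨D, hD, rfl⟩
  exact succ_le_card_of_isDomSet hD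

theorem mem_gammaSets_ladder {k : ℕ} {D : Finset (Fin 2 × Fin (2 * k + 1))} :
    D ∈ gammaSets (pathGraph 2 □ pathGraph (2 * k + 1)) ↔
      isDomSet (pathGraph 2 □ pathGraph (2 * k + 1)) D ∧ D.card = k + 1 := by
  simp [gammaSets, domNum_ladder]

theorem eq_alternatingSet_of_rowIndicator {t : Fin 2}
    (h : ∀ r, ∀ j < n, rowIndicator D r (j + 1) = if j % 4 = if r = t then 0 else 2 then 1 else 0) :
    D = alternatingSet n t := by
  ext ⟨r, j⟩
  have := h r j j.isLt
  rw [rowIndicator_succ] at this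
  rw [mem_alternatingSet]
  by_cases h1 : (r, j) ∈ D <;> simp_all

theorem gammaSets_ladder {k : ℕ} (hk : 2 ≤ k) :
    gammaSets (pathGraph 2 □ pathGraph (2 * k + 1)) =
      {alternatingSet (2 * k + 1) 0, alternatingSet (2 * k + 1) 1} := by
  ext D
  rw [mem_gammaSets_ladder, mem_insert, mem_singleton]
  constructor
  · rintro ⟨hD, hc⟩
    have hL := isLadderDom_of_isDomSet hD
    rw [card_eq_sum_rowIndicator] at hc
    have hs : 2 * ∑ j ∈ range (2 * k + 1), (rowIndicator D 0 (j + 1) + rowIndicator D 1 (j + 1)) =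
        2 * k + 1 + 1 := by omega
    have hends := hL.ends_eq_one (by omega) hs
    rcases (show rowIndicator D 0 1 = 1 ∨ rowIndicator D 1 1 = 1 by omega) with h1 | h1
    · left
      refine eq_alternatingSet_of_rowIndicator fun r j hj => ?_
      have := hL.eq_alternating (by omega) hs h1 j hj
      fin_cases r <;> simp [this]
    · right
      refine eq_alternatingSet_of_rowIndicator fun r j hj => ?_
      simp only [add_comm (rowIndicator D 0 _)] at hs
      have := hL.symm.eq_alternating (by omega) hs h1 j hj
      fin_cases r <;> simp [this]
  · rintro (rfl | rfl) <;> exact ⟨isDomSet_alternatingSet ⟨k, rfl⟩ _, card_alternatingSet k _⟩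

theorem DV_ladder {k : ℕ} (hk : 2 ≤ k) (r : Fin 2) (j : Fin (2 * k + 1)) :
    DV (pathGraph 2 □ pathGraph (2 * k + 1)) (r, j) = if Even (j : ℕ) then 1 else 0 := by
  rw [DV, gammaSets_ladder hk, filter_insert, filter_singleton]
  simp only [mem_alternatingSet, Nat.even_iff]
  fin_cases r <;> simp <;> split_ifs <;> first | omega | simp

theorem gammaSets_ladder_three :
    gammaSets (pathGraph 2 □ pathGraph 3) =
      {{(0, 0), (1, 2)}, {(1, 0), (0, 2)}, {(0, 1), (1, 1)}} := by
  ext D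
  rw [mem_gammaSets_ladder (k := 1)]
  simp only [isDomSet, ladder_adj, mem_insert, mem_singleton]
  revert D
  decide +kernel

end Ladder

theorem DV_P2_boxProd_Pn_odd :
    (∀ v : Fin 2 × Fin 3, DV (pathGraph 2 □ pathGraph 3) v = 1) ∧
    (∀ n : ℕ, Odd n → 5 ≤ n → ∀ i : ℕ, ∀ _h1 : 1 ≤ i, ∀ _h2 : i ≤ n,
      DV (pathGraph 2 □ pathGraph n) ((0 : Fin 2), (⟨i - 1, by omega⟩ : Fin n)) =
        (if Odd i then 1 else 0) ∧
      DV (pathGraph 2 □ pathGraph n) ((1 : Fin 2), (⟨i - 1, by omega⟩ : Fin n)) =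
        (if Odd i then 1 else 0)) := by
  refine ⟨fun v => ?_, fun n hn h5 i h1 h2 => ?_⟩
  · rw [DV, gammaSets_ladder_three]
    have h : ∀ v : Fin 2 × Fin 3, (filter (fun D : Finset (Fin 2 × Fin 3) => v ∈ D)
        {{(0, 0), (1, 2)}, {(1, 0), (0, 2)}, {(0, 1), (1, 1)}}).card = 1 := by
      decide +kernel
    convert h v
  · obtain ⟨k, rfl⟩ := hn
    have hpar : Even (i - 1) ↔ Odd i := by grind
    simp only [DV_ladder (show 2 ≤ k by omega), hpar, and_self]
end
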